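/- arXiv:1407.4548 — 3 statements merged into one kernel-verified Lean document; each statement's English description precedes it below -/
import Mathlib

section
/- Fix α with 0 ≤ α ≤ π/6 and let f_α(p) := p * (cos α + i sin α) * p⁻¹. Then the great 3-spheres Σ_p := {(x, p x f_α(p)⁻¹) : ‖x‖ = 1}, for p ranging over unit quaternions, form a fibration of the Clifford torus: for every pair of unit quaternions (x, y) there exists exactly one unit quaternion p with y = p * x * f_α(p)⁻¹. -/
open Quaternion

/-- The first quaternion imaginary unit `i`. -/
noncomputable def qi : ℍ[ℝ] := ⟨0, 1, 0, 0⟩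

/-- `f_α(p) = p (cos α + i sin α) p⁻¹`. -/
noncomputable def fAlpha (α : ℝ) (p : ℍ[ℝ]) : ℍ[ℝ] :=
  p * ((Real.cos α : ℍ[ℝ]) + (Real.sin α : ℍ[ℝ]) * qi) * p⁻¹

theorem qi_c1 : qi.re = 0 := rfl
theorem qi_c2 : qi.imI = 1 := rfl
theorem qi_c3 : qi.imJ = 0 := rfl
theorem qi_c4 : qi.imK = 0 := rfl

theorem aux_r (s c : ℝ) (hs0 : 0 ≤ s) (hs : s ≤ 1/2) (r : ℍ[ℝ]) (hr : ‖r‖ = 1) (h1 : r ≠ 1) :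
    ‖r * ((c : ℍ[ℝ]) + (s : ℍ[ℝ]) * qi) - ((c : ℍ[ℝ]) + (s : ℍ[ℝ]) * qi) * r‖ < ‖r - 1‖ := by
  have hn : Quaternion.normSq r = 1 := by
    rw [Quaternion.normSq_eq_norm_mul_self, hr]; norm_num
  rw [Quaternion.normSq_def'] at hn
  apply lt_of_pow_lt_pow_left₀ 2 (norm_nonneg _)
  rw [sq, sq, ← Quaternion.normSq_eq_norm_mul_self, ← Quaternion.normSq_eq_norm_mul_self,
    Quaternion.normSq_def', Quaternion.normSq_def']
  have ha : r.re < 1 := by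
    by_contra hcon
    push Not at hcon
    apply h1
    have e1 : r.re = 1 := by
      nlinarith [sq_nonneg r.imI, sq_nonneg r.imJ, sq_nonneg r.imK]
    rw [e1] at hn
    have e2 : r.imI = 0 := by
      apply pow_eq_zero_iff (two_ne_zero) |>.1
      nlinarith [sq_nonneg r.imI, sq_nonneg r.imJ, sq_nonneg r.imK]
    have e3 : r.imJ = 0 := by
      apply pow_eq_zero_iff (two_ne_zero) |>.1
      nlinarith [sq_nonneg r.imI, sq_nonneg r.imJ, sq_nonneg r.imK]
    have e4 : r.imK = 0 := by
      apply pow_eq_zero_iff (two_ne_zero) |>.1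
      nlinarith [sq_nonneg r.imI, sq_nonneg r.imJ, sq_nonneg r.imK]
    ext <;> simp [e1, e2, e3, e4]
  have h4 : 4 * s ^ 2 ≤ 1 := by nlinarith
  have h5 : 4 * s ^ 2 * (r.imJ ^ 2 + r.imK ^ 2) ≤ 1 * (r.imJ ^ 2 + r.imK ^ 2) := by gcongr
  have h6 : 0 < (1 - r.re) ^ 2 := by have : 0 < 1 - r.re := by linarith
                                     positivity
  simp [qi_c1, qi_c2, qi_c3, qi_c4]
  nlinarith [sq_nonneg r.imI]

theorem aux_f (α : ℝ) (hα : 0 ≤ α) (hα' : α ≤ Real.pi / 6) (p q : ℍ[ℝ]) (hp : ‖p‖ = 1)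
    (hq : ‖q‖ = 1) (h : p ≠ q) : ‖fAlpha α p - fAlpha α q‖ < ‖p - q‖ := by
  have hp0 : p ≠ 0 := by rintro rfl; simp at hp
  have hq0 : q ≠ 0 := by rintro rfl; simp at hq
  have hpi := Real.pi_pos
  have hs0 : 0 ≤ Real.sin α := Real.sin_nonneg_of_nonneg_of_le_pi hα (by linarith)
  have hs : Real.sin α ≤ 1 / 2 := by
    rw [← Real.sin_pi_div_six]
    exact Real.sin_le_sin_of_le_of_le_pi_div_two (by linarith) (by linarith) hα'
  have key := aux_r (Real.sin α) (Real.cos α) hs0 hs (q⁻¹ * p) (by simp [hp, hq]) (by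
    intro h'
    apply h
    have := congrArg (q * ·) h'
    simpa [← mul_assoc, hq0] using this)
  unfold fAlpha
  generalize ((Real.cos α : ℍ[ℝ]) + (Real.sin α : ℍ[ℝ]) * qi) = u at *
  have e1 : p * u * p⁻¹ - q * u * q⁻¹ = q * (q⁻¹ * p * u - u * (q⁻¹ * p)) * p⁻¹ := by
    simp only [mul_sub, sub_mul, mul_assoc, mul_inv_cancel₀ hp0, mul_one]
    simp only [← mul_assoc, mul_inv_cancel₀ hq0, one_mul]
  have e2 : p - q = q * (q⁻¹ * p - 1) := by
    simp only [mul_sub, ← mul_assoc, mul_inv_cancel₀ hq0, one_mul, mul_one]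
  rw [e1, e2]
  simpa [hp, hq] using key

theorem nonstandard_fibration (α : ℝ) (hα : 0 ≤ α) (hα' : α ≤ Real.pi / 6)
    (x y : ℍ[ℝ]) (hx : ‖x‖ = 1) (hy : ‖y‖ = 1) :
    ∃! p : ℍ[ℝ], ‖p‖ = 1 ∧ y = p * x * (fAlpha α p)⁻¹ := by
  have hx0 : x ≠ 0 := by rintro rfl; simp at hx
  have hu : ‖(Real.cos α : ℍ[ℝ]) + (Real.sin α : ℍ[ℝ]) * qi‖ = 1 := by
    have : ‖(Real.cos α : ℍ[ℝ]) + (Real.sin α : ℍ[ℝ]) * qi‖ ^ 2 = 1 := by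
      rw [sq, ← Quaternion.normSq_eq_norm_mul_self, Quaternion.normSq_def']
      simp [qi_c1, qi_c2, qi_c3, qi_c4]
    exact (pow_eq_one_iff_of_nonneg (norm_nonneg _) two_ne_zero).1 this
  have hf : ∀ p : ℍ[ℝ], ‖p‖ = 1 → ‖fAlpha α p‖ = 1 := by
    intro p hp
    simp only [fAlpha, norm_mul, norm_inv, hp, hu]; norm_num
  obtain ⟨g, hg⟩ : ∃ g : ℍ[ℝ] → ℍ[ℝ], ∀ p, g p = y * fAlpha α p * x⁻¹ := ⟨_, fun _ => rfl⟩
  have hiff : ∀ p : ℍ[ℝ], ‖p‖ = 1 → (y = p * x * (fAlpha α p)⁻¹ ↔ g p = p) := by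
    intro p hp
    have h0 : fAlpha α p ≠ 0 := by
      intro h; have := hf p hp; simp [h] at this
    rw [hg, eq_mul_inv_iff_mul_eq₀ h0, mul_inv_eq_iff_eq_mul₀ hx0]
  have hgn : ∀ p : ℍ[ℝ], ‖p‖ = 1 → ‖g p‖ = 1 := by
    intro p hp
    simp [hg, hf p hp, hx, hy]
  have hgl : ∀ p q : ℍ[ℝ], ‖p‖ = 1 → ‖q‖ = 1 → p ≠ q → ‖g p - g q‖ < ‖p - q‖ := by
    intro p q hp hq h
    have : g p - g q = y * (fAlpha α p - fAlpha α q) * x⁻¹ := by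
      simp only [hg, mul_sub, sub_mul]
    rw [this]
    simpa [hx, hy] using aux_f α hα hα' p q hp hq h
  have hcont : ContinuousOn (fun p : ℍ[ℝ] => ‖g p - p‖) (Metric.sphere 0 1) := by
    have : ContinuousOn (fun p : ℍ[ℝ] => p⁻¹) (Metric.sphere 0 1) := by
      apply continuousOn_id.inv₀
      intro p hp h
      simp at hp h
      simp [h] at hp
    simp only [hg, fAlpha]
    fun_prop
  have : ProperSpace ℍ[ℝ] := FiniteDimensional.proper ℝ _
  obtain ⟨p, hp, hmin⟩ := (isCompact_sphere (0 : ℍ[ℝ]) 1).exists_isMinOn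
    ⟨1, by simp⟩ hcont
  have hp1 : ‖p‖ = 1 := by simpa using hp
  have hfix : g p = p := by
    by_contra hne
    have h1 := hgl (g p) p (hgn p hp1) hp1 hne
    have h2 := hmin (show g p ∈ Metric.sphere (0 : ℍ[ℝ]) 1 by simpa using hgn p hp1)
    simp only [Set.mem_ofPred_eq] at h2
    linarith
  refine ⟨p, ⟨hp1, (hiff p hp1).2 hfix⟩, ?_⟩
  rintro q ⟨hq1, hq⟩
  have hq := (hiff q hq1).1 hq
  by_contra hne
  have := hgl q p hq1 hp1 hne
  rw [hq, hfix] at this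
  exact lt_irrefl _ this
end

section
/- Fix α ∈ ℝ and let f_α(p) := p * (cos α + i sin α) * p⁻¹, with fibers Σ_p := {(x, p x f_α(p)⁻¹) : ‖x‖ = 1}. For every unit quaternion q, the isometry of S³ × S³ given by (x, y) ↦ (x q⁻¹, q y q⁻¹) maps Σ_p bijectively onto Σ_{q·p} for every unit quaternion p. In particular the group of unit quaternions acts on S³ × S³ by isometries taking fibers to fibers and acting transitively on the set of fibers, so the fibration is fiberwise homogeneous. -/
open Quaternion

/-- The fiber `Σ_p = {(x, p x f_α(p)⁻¹) : x a unit quaternion}` in `ℍ × ℍ`. -/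
noncomputable def SigmaFiber (α : ℝ) (p : ℍ[ℝ]) : Set (ℍ[ℝ] × ℍ[ℝ]) :=
  {z | ∃ x : ℍ[ℝ], ‖x‖ = 1 ∧ z = (x, p * x * (fAlpha α p)⁻¹)}

/-- For every unit quaternion `q`, the isometry `(x, y) ↦ (x q⁻¹, q y q⁻¹)` of
`S³ × S³` maps each fiber `Σ_p` bijectively onto `Σ_{q p}`; so the group of unit quaternions
acts by isometries taking fibers to fibers, transitively on the set of fibers: the
fibration is fiberwise homogeneous. -/
theorem nonstandard_fibration_fiberwise_homogeneous (α : ℝ) (q : ℍ[ℝ]) (hq : ‖q‖ = 1)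
    (p : ℍ[ℝ]) (hp : ‖p‖ = 1) :
    Set.BijOn (fun z : ℍ[ℝ] × ℍ[ℝ] => (z.1 * q⁻¹, q * z.2 * q⁻¹))
      (SigmaFiber α p) (SigmaFiber α (q * p)) := by
  have hq0 : q ≠ 0 := by
    rintro rfl
    simp at hq
  have key : ∀ x : ℍ[ℝ], q * (p * x * (fAlpha α p)⁻¹) * q⁻¹
      = q * p * (x * q⁻¹) * (fAlpha α (q * p))⁻¹ := by
    intro x
    have h : fAlpha α (q * p) = q * fAlpha α p * q⁻¹ := by
      simp only [fAlpha, mul_inv_rev, mul_assoc]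
    rw [h]
    simp only [mul_inv_rev, inv_inv, mul_assoc]
    rw [inv_mul_cancel_left₀ hq0]
  refine ⟨?_, ?_, ?_⟩
  · rintro _ ⟨x, hx, rfl⟩
    exact ⟨x * q⁻¹, by simp [hx, hq], by simp only [key]⟩
  · rintro ⟨a, b⟩ _ ⟨c, d⟩ _ h
    simp only [Prod.mk.injEq] at h
    obtain ⟨h1, h2⟩ := h
    have hi := inv_ne_zero hq0
    exact Prod.ext (mul_right_cancel₀ hi h1)
      (mul_left_cancel₀ hq0 (mul_right_cancel₀ hi h2))
  · rintro _ ⟨x, hx, rfl⟩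
    refine ⟨(x * q, p * (x * q) * (fAlpha α p)⁻¹), ⟨x * q, by simp [hx, hq], rfl⟩, ?_⟩
    simp only [key, mul_inv_cancel_right₀ hq0]
end

section
/- Fix α with 0 < α ≤ π/6 and let f_α(p) := p * (cos α + i sin α) * p⁻¹, with fibers Σ_p := {(x, p x f_α(p)⁻¹) : ‖x‖ = 1}. Then there exist unit quaternions p and q such that Σ_p and Σ_q are disjoint and NOT parallel: the function z ↦ inf over unit y of √(dS(z, y)² + dS(p z f_α(p)⁻¹, q y f_α(q)⁻¹)²) on unit quaternions z is nonconstant. In particular, this fibration of S³ × S³ by great 3-spheres is not a Hopf fibration. -/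
open Quaternion

/-- Geodesic distance on the unit 3-sphere of quaternions: `dS(a,b) = arccos ⟪a, b⟫` where
`⟪a, b⟫ = re(a * star b)`. -/
noncomputable def dS (a b : ℍ[ℝ]) : ℝ := Real.arccos (a * star b).re

/-- Distance in the product metric from the point `(z, p z f_α(p)⁻¹)` of the fiber `Σ_p`
to the fiber `Σ_q = {(y, q y f_α(q)⁻¹)}`. -/
noncomputable def distFiber (α : ℝ) (p q z : ℍ[ℝ]) : ℝ :=
  sInf {v : ℝ | ∃ y : ℍ[ℝ], ‖y‖ = 1 ∧
    v = Real.sqrt (dS z y ^ 2 + dS (p * z * (fAlpha α p)⁻¹) (q * y * (fAlpha α q)⁻¹) ^ 2)}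


noncomputable def mk4 (a b c d : ℝ) : ℍ[ℝ] := ⟨a, b, c, d⟩
@[simp] lemma mk4_re (a b c d : ℝ) : (mk4 a b c d).re = a := rfl
@[simp] lemma mk4_imI (a b c d : ℝ) : (mk4 a b c d).imI = b := rfl
@[simp] lemma mk4_imJ (a b c d : ℝ) : (mk4 a b c d).imJ = c := rfl
@[simp] lemma mk4_imK (a b c d : ℝ) : (mk4 a b c d).imK = d := rfl

lemma aux_qi : qi = mk4 0 1 0 0 := rfl

lemma aux_f1 (α : ℝ) : (fAlpha α 1)⁻¹ = (mk4 (Real.cos α) (-Real.sin α) 0 0) := by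
  have h := Real.cos_sq_add_sin_sq α
  apply inv_eq_of_mul_eq_one_right
  ext <;> simp [fAlpha, aux_qi] <;> nlinarith

lemma aux_j : ((mk4 0 0 1 0) : ℍ[ℝ])⁻¹ = (mk4 0 0 (-1) 0) := by
  apply inv_eq_of_mul_eq_one_right
  ext <;> simp

lemma aux_fj (α : ℝ) : (fAlpha α (mk4 0 0 1 0))⁻¹ = (mk4 (Real.cos α) (Real.sin α) 0 0) := by
  have h := Real.cos_sq_add_sin_sq α
  apply inv_eq_of_mul_eq_one_right
  rw [fAlpha, aux_j]
  ext <;> simp [aux_qi] <;> nlinarith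

lemma aux_norm (a b c d : ℝ) (h : a^2+b^2+c^2+d^2 = 1) : ‖(mk4 a b c d : ℍ[ℝ])‖ = 1 := by
  have h1 : ‖(mk4 a b c d : ℍ[ℝ])‖ * ‖(mk4 a b c d : ℍ[ℝ])‖ = 1 := by
    rw [← Quaternion.normSq_eq_norm_mul_self, Quaternion.normSq_def']; exact h
  nlinarith [norm_nonneg (mk4 a b c d : ℍ[ℝ])]

lemma aux_norm' (x : ℍ[ℝ]) (h : ‖x‖ = 1) : x.re^2+x.imI^2+x.imJ^2+x.imK^2 = 1 := by
  rw [← Quaternion.normSq_def', Quaternion.normSq_eq_norm_mul_self, h]; norm_num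

lemma aux_arccos (c d : ℝ) (h : c^2 + d^2 ≤ 1) :
    Real.pi / 2 ≤ Real.arccos c + Real.arccos d := by
  have h1 : d ≤ Real.sin (Real.arccos c) := by
    rw [Real.sin_arccos]; exact Real.le_sqrt_of_sq_le (by linarith)
  by_cases hc : Real.arccos c ≤ Real.pi / 2
  · have h2 := Real.arccos_le_arccos h1
    rw [← Real.cos_pi_div_two_sub, Real.arccos_cos (by linarith)
      (by linarith [Real.arccos_nonneg c, Real.pi_pos])] at h2
    linarith
  · linarith [Real.arccos_nonneg d]

theorem nonstandard_fibration_not_hopf (α : ℝ) (hα : 0 < α) (hα' : α ≤ Real.pi / 6) :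
    ∃ p q : ℍ[ℝ], ‖p‖ = 1 ∧ ‖q‖ = 1 ∧
      (∀ x : ℍ[ℝ], ‖x‖ = 1 → p * x * (fAlpha α p)⁻¹ ≠ q * x * (fAlpha α q)⁻¹) ∧
      ∃ z w : ℍ[ℝ], ‖z‖ = 1 ∧ ‖w‖ = 1 ∧ distFiber α p q z ≠ distFiber α p q w := by
  have hpi := Real.pi_pos
  have hCS := Real.cos_sq_add_sin_sq α
  have h2 : 0 < Real.cos α ^ 2 - Real.sin α ^ 2 := by
    have : 0 < Real.cos (2 * α) := Real.cos_pos_of_mem_Ioo ⟨by linarith, by linarith⟩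
    rw [Real.cos_two_mul] at this
    linarith
  have hr : (√2 / 2) ^ 2 = (1 / 2 : ℝ) := by
    rw [div_pow, Real.sq_sqrt (by norm_num)]; norm_num
  have hc : Real.cos (Real.pi / 4 - α) = √2 / 2 * (Real.cos α + Real.sin α) := by
    rw [Real.cos_sub, Real.cos_pi_div_four, Real.sin_pi_div_four]; ring
  have hs : Real.sin (Real.pi / 4 - α) = √2 / 2 * (Real.cos α - Real.sin α) := by
    rw [Real.sin_sub, Real.cos_pi_div_four, Real.sin_pi_div_four]; ring
  have hcs := Real.cos_sq_add_sin_sq (Real.pi / 4 - α)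
  refine ⟨1, (mk4 0 0 1 0), by simp, aux_norm _ _ _ _ (by norm_num), ?_, 1,
    (mk4 (√2 / 2) 0 0 (-(√2 / 2))), by simp, aux_norm _ _ _ _ (by rw [neg_sq, hr]; norm_num), ?_⟩
  · intro x hx h
    rw [aux_f1, aux_fj] at h
    have hn := aux_norm' x hx
    have e1 := congrArg QuaternionAlgebra.re h
    have e2 := congrArg QuaternionAlgebra.imI h
    have e3 := congrArg QuaternionAlgebra.imJ h
    have e4 := congrArg QuaternionAlgebra.imK h
    simp at e1 e2 e3 e4
    generalize Real.cos α = C at *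
    generalize Real.sin α = S at *
    have k1 : (C^2 - S^2) * (x.re + x.imJ) = 0 := by linear_combination C * e1 - S * e4
    have k2 : (C^2 - S^2) * (x.imI + x.imK) = 0 := by linear_combination C * e4 - S * e1
    have k3 : (C^2 - S^2) * (x.re - x.imJ) = 0 := by linear_combination S * e2 - C * e3
    have k4 : (C^2 - S^2) * (x.imI - x.imK) = 0 := by linear_combination C * e2 - S * e3
    have z1 := (mul_eq_zero.1 k1).resolve_left h2.ne'
    have z2 := (mul_eq_zero.1 k2).resolve_left h2.ne'
    have z3 := (mul_eq_zero.1 k3).resolve_left h2.ne'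
    have z4 := (mul_eq_zero.1 k4).resolve_left h2.ne'
    have a1 : x.re = 0 := by linarith
    have a2 : x.imI = 0 := by linarith
    have a3 : x.imJ = 0 := by linarith
    have a4 : x.imK = 0 := by linarith
    rw [a1, a2, a3, a4] at hn
    norm_num at hn
  · apply ne_of_gt
    have hup : distFiber α 1 (mk4 0 0 1 0) (mk4 (√2 / 2) 0 0 (-(√2 / 2))) ≤
        √(2 * (Real.pi / 4 - α) ^ 2) := by
      apply csInf_le
      · exact ⟨0, by rintro _ ⟨y, _, rfl⟩; positivity⟩
      · refine ⟨mk4 (√2 / 2 * Real.cos (Real.pi / 4 - α)) (√2 / 2 * Real.sin (Real.pi / 4 - α))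
          (-(√2 / 2 * Real.sin (Real.pi / 4 - α))) (-(√2 / 2 * Real.cos (Real.pi / 4 - α))),
          aux_norm _ _ _ _ ?_, ?_⟩
        · generalize √2 / 2 = r at *
          linear_combination 2 * hr * (Real.cos (Real.pi / 4 - α) ^ 2
            + Real.sin (Real.pi / 4 - α) ^ 2) + hcs
        · rw [aux_f1, aux_fj, dS, dS]
          have g : Real.arccos (Real.cos (Real.pi / 4 - α)) = Real.pi / 4 - α :=
            Real.arccos_cos (by linarith) (by linarith)
          have t1 : ∀ a b : ℝ, a = Real.cos (Real.pi / 4 - α) → b = Real.cos (Real.pi / 4 - α) →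
              √(2 * (Real.pi / 4 - α) ^ 2) = √(Real.arccos a ^ 2 + Real.arccos b ^ 2) := by
            rintro _ _ rfl rfl
            rw [g]; congr 1; ring
          apply t1
          · simp
            generalize √2 / 2 = r at *
            linear_combination 2 * hr * Real.cos (Real.pi / 4 - α)
          · simp
            rw [hc, hs]
            generalize √2 / 2 = r at *
            generalize Real.cos α = C at *
            generalize Real.sin α = S at *
            linear_combination 2 * r ^ 2 * r * (C + S) * hCS + 2 * r * (C + S) * hr
    refine hup.trans_lt ?_
    have hlow : √(Real.pi ^ 2 / 8) ≤ distFiber α 1 (mk4 0 0 1 0) 1 := by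
      apply le_csInf
      · exact ⟨_, 1, by simp, rfl⟩
      · rintro _ ⟨y, hy, rfl⟩
        apply Real.sqrt_le_sqrt
        have hn := aux_norm' y hy
        rw [aux_f1, aux_fj, dS, dS]
        have := aux_arccos (1 * star y).re (1 * 1 * ((mk4 (Real.cos α) (-Real.sin α) 0 0) : ℍ[ℝ]) *
          star ((mk4 0 0 1 0) * y * ((mk4 (Real.cos α) (Real.sin α) 0 0) : ℍ[ℝ]))).re (by
            simp
            generalize Real.cos α = C at *
            generalize Real.sin α = S at *
            have k : (C ^ 2 - S ^ 2) ^ 2 + (2 * C * S) ^ 2 = 1 := by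
              linear_combination (C ^ 2 + S ^ 2 + 1) * hCS
            nlinarith [sq_nonneg (2 * C * S * y.imJ - (C ^ 2 - S ^ 2) * y.imK), sq_nonneg y.imI,
              congrArg (fun t => t * (y.imJ ^ 2 + y.imK ^ 2)) k])
        have key : ∀ a b : ℝ, Real.pi / 2 ≤ a + b → Real.pi ^ 2 / 8 ≤ a ^ 2 + b ^ 2 := by
          intro a b hab
          have : (Real.pi / 2) ^ 2 ≤ (a + b) ^ 2 := pow_le_pow_left₀ (by positivity) hab 2
          nlinarith [sq_nonneg (a - b)]
        exact key _ _ this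
    refine lt_of_lt_of_le (Real.sqrt_lt_sqrt (by positivity) ?_) hlow
    nlinarith
end
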